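/- Let m ≥ 4 and let e be an integer with 1 ≤ e < m/2 such that m/gcd(m,e) is even, and set ℓ = 2·gcd(m,e). Then the dual code C̄_e^⊥ has 𝔽₂-dimension 2m+1, and its weight distribution is: exactly 1 codeword each of weights 0 and 2^m; exactly 2^{m−ℓ}(2^m−1)/(2^{ℓ/2}+1) codewords of each of the weights 2^{m−1}−2^{(m+ℓ−2)/2} and 2^{m−1}+2^{(m+ℓ−2)/2}; exactly 2^{(2m+ℓ)/2}(2^m−1)/(2^{ℓ/2}+1) codewords of each of the weights 2^{m−1}−2^{(m−2)/2} and 2^{m−1}+2^{(m−2)/2}; exactly 2((2^{ℓ/2}−1)·2^{m−ℓ}+1)(2^m−1) codewords of weight 2^{m−1}; and no codewords of any other weight. In particular the minimum distance of C̄_e^⊥ is 2^{m−1}−2^{(m+ℓ−2)/2}. -/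

import Mathlib

noncomputable local instance (m : ℕ) : Fintype (GaloisField 2 m) := Fintype.ofFinite _
attribute [local instance] Classical.propDecidable

/-- `∑_{g∈F} ι(c(g))·g^s ∈ F = GF(2^m)`, where `ι : 𝔽₂ → F` is the unique ring hom. -/
noncomputable def phiF (m s : ℕ) :
    (GaloisField 2 m → ZMod 2) →ₗ[ZMod 2] GaloisField 2 m where
  toFun c := ∑ g, algebraMap (ZMod 2) (GaloisField 2 m) (c g) * g ^ s
  map_add' c d := by simp [add_mul, Finset.sum_add_distrib]
  map_smul' a c := by simp [Algebra.smul_def, mul_assoc, Finset.mul_sum]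

/-- The parity functional `c ↦ ∑_{g∈F} c(g) ∈ 𝔽₂`. -/
noncomputable def parF (m : ℕ) : (GaloisField 2 m → ZMod 2) →ₗ[ZMod 2] ZMod 2 where
  toFun c := ∑ g, c g
  map_add' c d := by simp [Finset.sum_add_distrib]
  map_smul' a c := by simp [Finset.mul_sum]

/-- The extended binary cyclic code `C̄_e` of length `2^m`, with coordinates indexed by
`F = GF(2^m)`: all `c : F → 𝔽₂` with `∑_{g∈F} c(g) = 0` in `𝔽₂`,
`∑_{g∈F} ι(c(g))·g = 0` and `∑_{g∈F} ι(c(g))·g^{2^e+1} = 0` in `F`. -/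
noncomputable def extCode (m e : ℕ) : Submodule (ZMod 2) (GaloisField 2 m → ZMod 2) :=
  LinearMap.ker (parF m) ⊓ LinearMap.ker (phiF m 1) ⊓ LinearMap.ker (phiF m (2 ^ e + 1))

/-- The dual code `C̄_e^⊥`. -/
noncomputable def dualCode (m e : ℕ) : Submodule (ZMod 2) (GaloisField 2 m → ZMod 2) where
  carrier := {y | ∀ c ∈ extCode m e, ∑ g, c g * y g = 0}
  add_mem' := by
    intro a b ha hb c hc
    simp only [Pi.add_apply, mul_add, Finset.sum_add_distrib, ha c hc, hb c hc, add_zero]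
  zero_mem' := by intro c hc; simp
  smul_mem' := by
    intro a y hy c hc
    simp only [Pi.smul_apply, smul_eq_mul, mul_left_comm, ← Finset.mul_sum, hy c hc, mul_zero]

/-- The Hamming weight of a codeword. -/
noncomputable def wt {m : ℕ} (y : GaloisField 2 m → ZMod 2) : ℕ :=
  (Finset.univ.filter fun g => y g ≠ 0).card

section Walsh

variable {F : Type*} [Field F] [Fintype F] [Algebra (ZMod 2) F]

/-- The nontrivial additive character `x ↦ (-1)^x` of `𝔽₂`. -/
def binarySign : AddChar (ZMod 2) ℤ :=
  AddChar.zmodChar 2 (ζ := -1) (by norm_num)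

theorem binarySign_eq_ite (x : ZMod 2) : binarySign x = if x = 0 then 1 else -1 := by
  rw [binarySign, AddChar.zmodChar_apply]
  fin_cases x
  · rfl
  · rfl

theorem binarySign_injective : Function.Injective binarySign := by
  have h (c : ZMod 2) : c = 0 ∨ c = 1 := by
    fin_cases c
    · exact Or.inl rfl
    · exact Or.inr rfl
  intro c c' hc
  rw [binarySign_eq_ite, binarySign_eq_ite] at hc
  rcases h c with rfl | rfl <;> rcases h c' with rfl | rfl <;> simp at hc ⊢

theorem binarySign_sq (x : ZMod 2) : binarySign x ^ 2 = 1 := by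
  rw [binarySign_eq_ite]
  split_ifs <;> norm_num

theorem sum_binarySign {ι : Type*} [Fintype ι] (f : ι → ZMod 2) :
    ∑ i, binarySign (f i) =
      Fintype.card ι - 2 * ((Finset.univ.filter fun i => f i ≠ 0).card : ℤ) := by
  have h (i : ι) : binarySign (f i) = 1 - 2 * (if f i ≠ 0 then 1 else 0) := by
    rw [binarySign_eq_ite]
    by_cases hi : f i = 0 <;> simp [hi]
  simp only [h, Finset.sum_sub_distrib, ← Finset.mul_sum, Finset.sum_boole]
  simp

/-- The canonical additive character `x ↦ (-1)^(Tr x)` of a finite field of characteristic two. -/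
noncomputable def traceSign (F : Type*) [Field F] [Algebra (ZMod 2) F] : AddChar F ℤ :=
  binarySign.compAddMonoidHom (Algebra.trace (ZMod 2) F).toAddMonoidHom

omit [Fintype F] in
theorem traceSign_apply (x : F) : traceSign F x = binarySign (Algebra.trace (ZMod 2) F x) := rfl

theorem traceSign_isPrimitive : (traceSign F).IsPrimitive := by
  apply AddChar.IsPrimitive.of_ne_one
  intro h
  obtain ⟨x, hx⟩ := Algebra.trace_surjective (ZMod 2) F 1
  have := DFunLike.congr_fun h x
  rw [traceSign_apply, hx, binarySign_eq_ite] at this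
  simp at this

theorem sum_traceSign_mul (u : F) :
    ∑ x, traceSign F (x * u) = if u = 0 then (Fintype.card F : ℤ) else 0 := by
  rw [AddChar.sum_mulShift u traceSign_isPrimitive]
  split_ifs <;> simp

omit [Fintype F] in
theorem traceSign_sq (x : F) : traceSign F x ^ 2 = 1 := binarySign_sq _

omit [Algebra (ZMod 2) F] in
theorem bijective_pow_two_pow [CharP F 2] (e : ℕ) : Function.Bijective fun x : F => x ^ 2 ^ e :=
  (iterateFrobeniusEquiv F 2 e).bijective

theorem trace_pow_two_pow [CharP F 2] (e : ℕ) (x : F) :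
    Algebra.trace (ZMod 2) F (x ^ 2 ^ e) = Algebra.trace (ZMod 2) F x := by
  induction e with
  | zero => simp
  | succ e ih =>
    rw [pow_succ, pow_mul, ← ih]
    have := Algebra.trace_eq_of_algEquiv (FiniteField.frobeniusAlgEquiv (ZMod 2) F 2) (x ^ 2 ^ e)
    simpa using this

/-- The Walsh coefficient `∑ₓ (-1)^(Tr(a x^(2^e+1) + b x))`. -/
noncomputable def walsh (e : ℕ) (a b : F) : ℤ :=
  ∑ x, traceSign F (a * x ^ (2 ^ e + 1) + b * x)

/-- The radical of the quadratic form `x ↦ Tr(a x^(2^e+1))`. -/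
def quadRadical [CharP F 2] (e : ℕ) (a : F) : AddSubgroup F where
  carrier := {u | a ^ 2 ^ e * (u ^ 2 ^ e) ^ 2 ^ e + a * u = 0}
  zero_mem' := by simp
  add_mem' := by
    intro u v hu hv
    simp only [Set.mem_ofPred_eq] at *
    rw [add_pow_char_pow, add_pow_char_pow]
    linear_combination hu + hv
  neg_mem' := by
    intro u hu
    rwa [CharTwo.neg_eq]

omit [Fintype F] [Algebra (ZMod 2) F] in
theorem mem_quadRadical [CharP F 2] {e : ℕ} {a u : F} :
    u ∈ quadRadical e a ↔ a ^ 2 ^ e * (u ^ 2 ^ e) ^ 2 ^ e + a * u = 0 := Iff.rfl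

theorem traceSign_polar [CharP F 2] (e : ℕ) (a u y : F) :
    traceSign F (a * (u ^ 2 ^ e * y + u * y ^ 2 ^ e)) =
      traceSign F (y ^ 2 ^ e * (a ^ 2 ^ e * (u ^ 2 ^ e) ^ 2 ^ e + a * u)) := by
  have h := trace_pow_two_pow e (a * u ^ 2 ^ e * y)
  rw [mul_pow, mul_pow] at h
  rw [traceSign_apply, traceSign_apply]
  congr 1
  rw [mul_add, mul_add, map_add, map_add, ← mul_assoc, ← h]
  congr 2 <;> ring

theorem sum_traceSign_polar [CharP F 2] (e : ℕ) (a u : F) :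
    ∑ y, traceSign F (a * (u ^ 2 ^ e * y + u * y ^ 2 ^ e)) =
      if u ∈ quadRadical e a then (Fintype.card F : ℤ) else 0 := by
  simp only [traceSign_polar]
  rw [(bijective_pow_two_pow e).sum_comp
    (fun z : F => traceSign F (z * (a ^ 2 ^ e * (u ^ 2 ^ e) ^ 2 ^ e + a * u))), sum_traceSign_mul]
  rfl

omit [Fintype F] in
theorem traceSign_quad_add [CharP F 2] (e : ℕ) (a b u y : F) :
    traceSign F (a * (u + y) ^ (2 ^ e + 1) + b * (u + y)) =
      traceSign F (a * u ^ (2 ^ e + 1) + b * u) * traceSign F (a * y ^ (2 ^ e + 1) + b * y) *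
        traceSign F (a * (u ^ 2 ^ e * y + u * y ^ 2 ^ e)) := by
  rw [← AddChar.map_add_eq_mul, ← AddChar.map_add_eq_mul, pow_succ, add_pow_char_pow]
  congr 1
  ring

theorem walsh_sq [CharP F 2] (e : ℕ) (a b : F) :
    walsh e a b ^ 2 = Fintype.card F *
      ∑ u : quadRadical e a, traceSign F (a * (u : F) ^ (2 ^ e + 1) + b * u) := by
  have h : walsh e a b ^ 2 = ∑ u, traceSign F (a * u ^ (2 ^ e + 1) + b * u) *
      ∑ y, traceSign F (a * (u ^ 2 ^ e * y + u * y ^ 2 ^ e)) := by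
    rw [sq, walsh, Finset.sum_mul_sum, Finset.sum_comm]
    have (y : F) : ∑ x, traceSign F (a * x ^ (2 ^ e + 1) + b * x) *
        traceSign F (a * y ^ (2 ^ e + 1) + b * y) =
        ∑ u, traceSign F (a * u ^ (2 ^ e + 1) + b * u) *
          traceSign F (a * (u ^ 2 ^ e * y + u * y ^ 2 ^ e)) := by
      rw [← Equiv.sum_comp (Equiv.addRight y)]
      refine Finset.sum_congr rfl fun u _ => ?_
      rw [Equiv.coe_addRight, traceSign_quad_add]
      linear_combination traceSign F (a * u ^ (2 ^ e + 1) + b * u) *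
          traceSign F (a * (u ^ 2 ^ e * y + u * y ^ 2 ^ e)) *
          traceSign_sq (a * y ^ (2 ^ e + 1) + b * y)
    simp only [this]
    rw [Finset.sum_comm]
    simp only [Finset.mul_sum]
  rw [h, Finset.mul_sum]
  simp only [sum_traceSign_polar, mul_ite, mul_zero]
  rw [← Finset.sum_filter]
  rw [Finset.sum_subtype (p := fun u => u ∈ quadRadical e a) _ (by simp)]
  exact Finset.sum_congr rfl fun u _ => mul_comm _ _

/-- On the radical, `x ↦ (-1)^(Tr(a x^(2^e+1) + b x))` is a character. -/
noncomputable def radicalChar [CharP F 2] (e : ℕ) (a b : F) : AddChar (quadRadical e a) ℤ where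
  toFun u := traceSign F (a * (u : F) ^ (2 ^ e + 1) + b * u)
  map_zero_eq_one' := by simp
  map_add_eq_mul' := by
    intro u y
    have hu := u.2
    rw [mem_quadRadical] at hu
    rw [AddSubgroup.coe_add, traceSign_quad_add, traceSign_polar, hu]
    simp

theorem walsh_sq_eq_zero_or [CharP F 2] (e : ℕ) (a b : F) :
    walsh e a b ^ 2 = 0 ∨ walsh e a b ^ 2 = Fintype.card F * Nat.card (quadRadical e a) := by
  have h := AddChar.sum_eq_ite (radicalChar e a b)
  rw [walsh_sq]
  change ∑ u : quadRadical e a, traceSign F (a * (u : F) ^ (2 ^ e + 1) + b * u) = _ at h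
  rw [h, Nat.card_eq_fintype_card]
  split_ifs <;> simp

theorem sum_walsh_sq [CharP F 2] (e : ℕ) (a : F) :
    ∑ b, walsh e a b ^ 2 = (Fintype.card F : ℤ) ^ 2 := by
  simp only [walsh_sq]
  rw [← Finset.mul_sum, Finset.sum_comm, sq]
  congr 1
  simp only [AddChar.map_add_eq_mul, ← Finset.mul_sum, sum_traceSign_mul]
  rw [Finset.sum_eq_single 0]
  · simp
  · intro u _ hu
    simp [hu]
  · simp

theorem card_quadRadical_mul_card_walsh_ne_zero [CharP F 2] (e : ℕ) (a : F) :
    Nat.card (quadRadical e a) * (Finset.univ.filter fun b => walsh e a b ≠ 0).card =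
      Fintype.card F := by
  have h := sum_walsh_sq e a
  have h1 (b : F) : walsh e a b ^ 2 =
      if walsh e a b ≠ 0 then (Fintype.card F * Nat.card (quadRadical e a) : ℤ) else 0 := by
    split_ifs with hb
    · exact (walsh_sq_eq_zero_or e a b).resolve_left (pow_ne_zero 2 hb)
    · simp [not_not.1 hb]
  simp only [h1] at h
  rw [← Finset.sum_filter, Finset.sum_const, nsmul_eq_mul, sq] at h
  have hF : (Fintype.card F : ℤ) ≠ 0 := by exact_mod_cast Fintype.card_ne_zero
  have : (Fintype.card F : ℤ) * (Nat.card (quadRadical e a) *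
      ((Finset.univ.filter fun b => walsh e a b ≠ 0).card : ℤ)) = Fintype.card F * Fintype.card F := by
    linear_combination h
  exact_mod_cast mul_left_cancel₀ hF this

/-- For nonzero `s`, each `a` whose radical has order `w`, `s = |F| w`, contributes `|F| / w`. -/
theorem card_walsh_sq_eq [CharP F 2] (e w : ℕ) (hw : w ≠ 0) (a : F) :
    (Finset.univ.filter fun b => walsh e a b ^ 2 = Fintype.card F * w).card =
      if Nat.card (quadRadical e a) = w then Fintype.card F / w else 0 := by
  have hF : (Fintype.card F : ℤ) ≠ 0 := by exact_mod_cast Fintype.card_ne_zero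
  have hw' : (w : ℤ) ≠ 0 := by exact_mod_cast hw
  split_ifs with h
  · subst h
    rw [← card_quadRadical_mul_card_walsh_ne_zero e a,
      Nat.mul_div_cancel_left _ (Nat.pos_of_ne_zero hw)]
    congr 1
    ext b
    simp only [Finset.mem_filter, Finset.mem_univ, true_and]
    constructor
    · intro hb h0
      rw [card_quadRadical_mul_card_walsh_ne_zero, h0] at hb
      simp_all
    · intro hb
      rw [card_quadRadical_mul_card_walsh_ne_zero]
      exact (walsh_sq_eq_zero_or e a b).resolve_left (pow_ne_zero 2 hb)
  · rw [Finset.card_eq_zero, Finset.filter_eq_empty_iff]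
    intro b _ hb
    rcases walsh_sq_eq_zero_or e a b with h0 | h0
    · rw [h0] at hb
      exact mul_ne_zero hF hw' hb.symm
    · rw [h0] at hb
      exact h (by exact_mod_cast mul_left_cancel₀ hF hb)

end Walsh

section Radical

theorem gcd_two_mul_of_even_div {m e : ℕ} (he : 1 ≤ e) (heven : Even (m / Nat.gcd m e)) :
    Nat.gcd m (2 * e) = 2 * Nat.gcd m e := by
  have hd0 : 0 < Nat.gcd m e := Nat.gcd_pos_of_pos_right m he
  obtain ⟨i, hi⟩ := heven
  have hco := Nat.coprime_div_gcd_div_gcd hd0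
  rw [hi, ← two_mul] at hco
  have hm : m = Nat.gcd m e * (2 * i) := by
    rw [two_mul, ← hi, Nat.mul_div_cancel' (Nat.gcd_dvd_left m e)]
  have he' := (Nat.mul_div_cancel' (Nat.gcd_dvd_right m e)).symm
  calc Nat.gcd m (2 * e) =
      Nat.gcd (Nat.gcd m e * (2 * i)) (Nat.gcd m e * (2 * (e / Nat.gcd m e))) := by
        rw [← hm, mul_left_comm, ← he']
    _ = 2 * Nat.gcd m e := by
        rw [Nat.gcd_mul_left, Nat.gcd_mul_left, (hco.coprime_dvd_left (dvd_mul_left i 2)), mul_one,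
          mul_comm]

theorem gcd_two_pow_add_one {m e d : ℕ} (hd : d = Nat.gcd m e) (he : 1 ≤ e)
    (heven : Even (m / d)) : Nat.gcd (2 ^ m - 1) (2 ^ e + 1) = 2 ^ d + 1 := by
  have hd0 : 0 < d := hd ▸ Nat.gcd_pos_of_pos_right m he
  obtain ⟨k, hk⟩ : d ∣ e := hd ▸ Nat.gcd_dvd_right m e
  obtain ⟨j, hj⟩ : d ∣ m := hd ▸ Nat.gcd_dvd_left m e
  obtain ⟨i, hi⟩ := id heven
  rw [hj, Nat.mul_div_cancel_left _ hd0] at hi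
  have hco : Nat.Coprime j k := by
    rw [hj, hk, Nat.gcd_mul_left] at hd
    exact Nat.eq_of_mul_eq_mul_left hd0 (by omega)
  have hodd : Odd k := by
    rw [← Nat.not_even_iff_odd]
    intro h
    have := Nat.dvd_gcd (show 2 ∣ j by omega) h.two_dvd
    rw [hco] at this
    omega
  have hfac : 2 ^ (2 * d) - 1 = (2 ^ d + 1) * (2 ^ d - 1) := by
    rw [mul_comm 2 d, pow_mul, ← one_pow 2, Nat.sq_sub_sq, one_pow]
  apply Nat.dvd_antisymm
  · have h1 : Nat.gcd (2 ^ m - 1) (2 ^ e + 1) ∣ (2 ^ d + 1) * (2 ^ d - 1) := by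
      have h2 : 2 * d = Nat.gcd m (2 * e) := by
        rw [gcd_two_mul_of_even_div he (hd ▸ heven), hd]
      rw [← hfac, h2, ← Nat.pow_sub_one_gcd_pow_sub_one]
      refine Nat.gcd_dvd_gcd_of_dvd_right _ ⟨2 ^ e - 1, ?_⟩
      rw [mul_comm 2 e, pow_mul, ← one_pow 2, Nat.sq_sub_sq, one_pow]
    refine Nat.Coprime.dvd_of_dvd_mul_right ?_ h1
    refine Nat.Coprime.coprime_dvd_left (Nat.gcd_dvd_right _ _) ?_
    have h2 : 2 ^ d - 1 ∣ 2 ^ e - 1 := Nat.pow_sub_one_dvd_pow_sub_one 2 ⟨k, hk⟩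
    have h3 : Nat.gcd (2 ^ e + 1) (2 ^ d - 1) ∣ 2 := by
      have := Nat.dvd_sub (Nat.gcd_dvd_left (2 ^ e + 1) (2 ^ d - 1))
        ((Nat.gcd_dvd_right (2 ^ e + 1) (2 ^ d - 1)).trans h2)
      have hp := Nat.one_le_two_pow (n := e)
      rwa [show 2 ^ e + 1 - (2 ^ e - 1) = 2 by omega] at this
    rcases (Nat.dvd_prime Nat.prime_two).1 h3 with h | h
    · exact h
    · have h4 := Nat.gcd_dvd_right (2 ^ e + 1) (2 ^ d - 1)
      rw [h] at h4
      have h5 : 2 ∣ 2 ^ d := dvd_pow_self 2 hd0.ne'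
      have hp := Nat.one_le_two_pow (n := d)
      omega
  · apply Nat.dvd_gcd
    · have : 2 ^ (2 * d) - 1 ∣ 2 ^ m - 1 := by
        apply Nat.pow_sub_one_dvd_pow_sub_one
        exact ⟨i, by rw [hj, hi]; ring⟩
      exact (Dvd.intro _ hfac.symm).trans this
    · have := hodd.nat_add_dvd_pow_add_pow (2 ^ d) 1
      rwa [one_pow, ← pow_mul, ← hk] at this

variable {F : Type*} [Field F] [Fintype F] [CharP F 2]

theorem card_quadRadical_zero (e : ℕ) : Nat.card (quadRadical e (0 : F)) = Fintype.card F := by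
  have : quadRadical e (0 : F) = ⊤ := by
    ext u
    simp [mem_quadRadical]
  rw [this, AddSubgroup.card_top, Nat.card_eq_fintype_card]

omit [Fintype F] in
theorem mem_quadRadical_units {e : ℕ} {a u : Fˣ} :
    (u : F) ∈ quadRadical e (a : F) ↔ (a * u ^ (2 ^ e + 1)) ^ (2 ^ e - 1) = 1 := by
  rw [mem_quadRadical, CharTwo.add_eq_zero]
  norm_cast
  have h : a ^ 2 ^ e * (u ^ 2 ^ e) ^ 2 ^ e = (a * u ^ (2 ^ e + 1)) ^ (2 ^ e - 1) * (a * u) := by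
    obtain ⟨q, hq⟩ : ∃ q, 2 ^ e = q + 1 := ⟨2 ^ e - 1, by have := Nat.one_le_two_pow (n := e); omega⟩
    rw [hq, Nat.add_sub_cancel, mul_pow, ← pow_mul, ← pow_mul, pow_succ a, mul_mul_mul_comm,
      ← pow_succ u]
    congr 2
    ring
  rw [h, mul_eq_right]

/-- The radical of the form attached to a nonzero `a` consists of zero and the solutions of
`(a u^(2^e+1))^(2^e-1) = 1`. -/
theorem card_quadRadical_units (e : ℕ) (a : Fˣ) :
    Nat.card (quadRadical e (a : F)) =
      Nat.card {u : Fˣ // (a * u ^ (2 ^ e + 1)) ^ (2 ^ e - 1) = 1} + 1 := by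
  rw [← Finite.card_option]
  symm
  let f : Option {u : Fˣ // (a * u ^ (2 ^ e + 1)) ^ (2 ^ e - 1) = 1} → quadRadical e (a : F)
    | none => 0
    | some u => ⟨((u : Fˣ) : F), mem_quadRadical_units.2 u.2⟩
  refine Nat.card_congr (Equiv.ofBijective f ⟨?_, ?_⟩)
  · rintro (_ | u) (_ | v) h
    · rfl
    · exact absurd (congrArg Subtype.val h).symm v.1.ne_zero
    · exact absurd (congrArg Subtype.val h) u.1.ne_zero
    · exact congrArg some (Subtype.ext (Units.ext (congrArg Subtype.val h)))
  · rintro ⟨x, hx⟩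
    by_cases h0 : x = 0
    · exact ⟨none, Subtype.ext h0.symm⟩
    · exact ⟨some ⟨Units.mk0 x h0, mem_quadRadical_units.1 hx⟩, rfl⟩

omit [CharP F 2] in
theorem natCard_units_of_card {m : ℕ} (hF : Fintype.card F = 2 ^ m) : Nat.card Fˣ = 2 ^ m - 1 := by
  rw [Nat.card_units, Nat.card_eq_fintype_card, hF]

theorem card_quadRadical_of_mem_range {m e : ℕ} (hF : Fintype.card F = 2 ^ m) {a : Fˣ}
    (ha : a ∈ (powMonoidHom (2 ^ e + 1) : Fˣ →* Fˣ).range) :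
    Nat.card (quadRadical e (a : F)) = 2 ^ Nat.gcd m (2 * e) := by
  obtain ⟨v, rfl⟩ := ha
  have h : Nat.card {u : Fˣ // (powMonoidHom (2 ^ e + 1) v * u ^ (2 ^ e + 1)) ^ (2 ^ e - 1) = 1} =
      Nat.card (powMonoidHom (2 ^ (2 * e) - 1) : Fˣ →* Fˣ).ker := by
    refine Nat.card_congr ((Equiv.mulLeft v).subtypeEquiv fun u => ?_)
    rw [MonoidHom.mem_ker, powMonoidHom_apply, powMonoidHom_apply, Equiv.coe_mulLeft, ← mul_pow,
      ← pow_mul, mul_comm 2 e, pow_mul 2 e 2, ← one_pow 2, Nat.sq_sub_sq, one_pow]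
  rw [card_quadRadical_units, h, IsCyclic.card_powMonoidHom_ker, natCard_units_of_card hF,
    Nat.pow_sub_one_gcd_pow_sub_one]
  exact Nat.sub_add_cancel Nat.one_le_two_pow

theorem IsCyclic.powMonoidHom_range_eq_ker (G : Type*) [CommGroup G] [IsCyclic G] [Finite G]
    (d : ℕ) : (powMonoidHom d : G →* G).range =
      (powMonoidHom (Nat.card G / (Nat.card G).gcd d) : G →* G).ker := by
  apply Subgroup.eq_of_le_of_card_ge
  · rintro _ ⟨x, rfl⟩
    rw [MonoidHom.mem_ker, powMonoidHom_apply, powMonoidHom_apply, ← pow_mul,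
      ← Nat.mul_div_assoc _ (Nat.gcd_dvd_left _ _), mul_comm,
      Nat.mul_div_assoc _ (Nat.gcd_dvd_right _ _), pow_mul, pow_card_eq_one', one_pow]
  · rw [IsCyclic.card_powMonoidHom_range, IsCyclic.card_powMonoidHom_ker]
    exact Nat.gcd_le_right _ (Nat.div_pos (Nat.gcd_le_left _ Nat.card_pos)
      (Nat.gcd_pos_of_pos_left _ Nat.card_pos))

theorem card_quadRadical_of_notMem_range {m e d : ℕ} (hF : Fintype.card F = 2 ^ m)
    (hd : d = Nat.gcd m e) (he : 1 ≤ e)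
    (heven : Even (m / d)) {a : Fˣ}
    (ha : a ∉ (powMonoidHom (2 ^ e + 1) : Fˣ →* Fˣ).range) :
    Nat.card (quadRadical e (a : F)) = 1 := by
  have hemp : IsEmpty {u : Fˣ // (a * u ^ (2 ^ e + 1)) ^ (2 ^ e - 1) = 1} := by
    refine ⟨fun ⟨u, hu⟩ => ha ?_⟩
    rw [← Subgroup.mul_mem_cancel_right _
      (show u ^ (2 ^ e + 1) ∈ (powMonoidHom (2 ^ e + 1) : Fˣ →* Fˣ).range from ⟨u, rfl⟩),
      IsCyclic.powMonoidHom_range_eq_ker, MonoidHom.mem_ker, powMonoidHom_apply,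
      natCard_units_of_card hF, gcd_two_pow_add_one hd he heven]
    have h1 : (a * u ^ (2 ^ e + 1)) ^ (2 ^ d - 1) = 1 := by
      rw [hd, ← Nat.pow_sub_one_gcd_pow_sub_one, pow_gcd_eq_one]
      refine ⟨?_, hu⟩
      rw [← natCard_units_of_card hF, pow_card_eq_one']
    have h2 : 2 ^ d - 1 ∣ (2 ^ m - 1) / (2 ^ d + 1) := by
      apply Nat.dvd_div_of_mul_dvd
      have hfac : 2 ^ (d * 2) - 1 = (2 ^ d + 1) * (2 ^ d - 1) := by
        rw [pow_mul, ← one_pow 2, Nat.sq_sub_sq, one_pow]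
      rw [← hfac]
      apply Nat.pow_sub_one_dvd_pow_sub_one
      have hdm : d ∣ m := hd ▸ Nat.gcd_dvd_left m e
      exact Nat.mul_dvd_of_dvd_div hdm heven.two_dvd
    obtain ⟨k, hk⟩ := h2
    rw [hk, pow_mul, h1, one_pow]
  rw [card_quadRadical_units, Nat.card_of_isEmpty]

end Radical

section Distribution

variable {F : Type*} [Field F] [Fintype F] [CharP F 2]

theorem sum_card_quadRadical {m e d : ℕ} (hF : Fintype.card F = 2 ^ m)
    (hd : d = Nat.gcd m e) (he : 1 ≤ e) (heven : Even (m / d)) (g : ℕ → ℕ) :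
    ∑ a : F, g (Nat.card (quadRadical e a)) = g (2 ^ m) +
      (2 ^ m - 1) / (2 ^ d + 1) * g (2 ^ (2 * d)) +
      (2 ^ m - 1 - (2 ^ m - 1) / (2 ^ d + 1)) * g 1 := by
  rw [Fintype.sum_eq_add_sum_subtype_ne _ (0 : F), card_quadRadical_zero, hF, add_assoc]
  congr 1
  rw [← Equiv.sum_comp unitsEquivNeZero]
  have h (u : Fˣ) : g (Nat.card (quadRadical e ((unitsEquivNeZero u : {a : F // a ≠ 0}) : F))) =
      if u ∈ (powMonoidHom (2 ^ e + 1) : Fˣ →* Fˣ).range then g (2 ^ (2 * d)) else g 1 := by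
    split_ifs with hu
    · rw [hd, ← gcd_two_mul_of_even_div he (hd ▸ heven), ← card_quadRadical_of_mem_range hF hu]
      rfl
    · rw [← card_quadRadical_of_notMem_range hF hd he heven hu]
      rfl
  simp only [h]
  have hr : (Finset.univ.filter fun u => u ∈ (powMonoidHom (2 ^ e + 1) : Fˣ →* Fˣ).range).card =
      (2 ^ m - 1) / (2 ^ d + 1) := by
    rw [← gcd_two_pow_add_one hd he heven, ← natCard_units_of_card hF,
      ← IsCyclic.card_powMonoidHom_range, Nat.card_eq_fintype_card, Fintype.card_subtype]
  have hc := Finset.card_filter_add_card_filter_not (s := (Finset.univ : Finset Fˣ))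
    (fun u => u ∈ (powMonoidHom (2 ^ e + 1) : Fˣ →* Fˣ).range)
  rw [hr, Finset.card_univ, ← Nat.card_eq_fintype_card, natCard_units_of_card hF] at hc
  rw [Finset.sum_ite, Finset.sum_const, Finset.sum_const, hr, smul_eq_mul, smul_eq_mul]
  congr 2
  exact Nat.eq_sub_of_add_eq' hc

theorem card_quadRadical_mem {m e d : ℕ} (hF : Fintype.card F = 2 ^ m)
    (hd : d = Nat.gcd m e) (he : 1 ≤ e) (heven : Even (m / d)) (a : F) :
    Nat.card (quadRadical e a) = 2 ^ m ∨ Nat.card (quadRadical e a) = 2 ^ (2 * d) ∨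
      Nat.card (quadRadical e a) = 1 := by
  by_cases ha : a = 0
  · rw [ha, card_quadRadical_zero, hF]
    exact Or.inl rfl
  · obtain ⟨u, rfl⟩ : ∃ u : Fˣ, (u : F) = a := ⟨Units.mk0 a ha, rfl⟩
    by_cases hu : u ∈ (powMonoidHom (2 ^ e + 1) : Fˣ →* Fˣ).range
    · have h := card_quadRadical_of_mem_range hF hu
      rw [gcd_two_mul_of_even_div he (hd ▸ heven), ← hd] at h
      exact Or.inr (Or.inl h)
    · exact Or.inr (Or.inr (card_quadRadical_of_notMem_range hF hd he heven hu))

variable [Algebra (ZMod 2) F]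

theorem card_walsh_pair_sq_eq {m e d : ℕ} (hF : Fintype.card F = 2 ^ m)
    (hd : d = Nat.gcd m e) (he : 1 ≤ e) (heven : Even (m / d)) (w : ℕ) (hw : w ≠ 0) :
    (Finset.univ.filter fun p : F × F => walsh e p.1 p.2 ^ 2 = 2 ^ m * w).card =
      (if 2 ^ m = w then 2 ^ m / w else 0) +
      (2 ^ m - 1) / (2 ^ d + 1) * (if 2 ^ (2 * d) = w then 2 ^ m / w else 0) +
      (2 ^ m - 1 - (2 ^ m - 1) / (2 ^ d + 1)) * (if 1 = w then 2 ^ m / w else 0) := by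
  rw [← sum_card_quadRadical hF hd he heven (fun r => if r = w then 2 ^ m / w else 0),
    Finset.card_filter, Fintype.sum_prod_type]
  refine Finset.sum_congr rfl fun a _ => ?_
  rw [← hF, ← card_walsh_sq_eq e w hw a, Finset.card_filter, hF]
  push_cast
  rfl

theorem card_walsh_pair_eq_zero {m e d : ℕ} (hF : Fintype.card F = 2 ^ m)
    (hd : d = Nat.gcd m e) (he : 1 ≤ e) (heven : Even (m / d)) :
    (Finset.univ.filter fun p : F × F => walsh e p.1 p.2 = 0).card =
      2 ^ m - 1 + (2 ^ m - 1) / (2 ^ d + 1) * (2 ^ m - 2 ^ m / 2 ^ (2 * d)) := by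
  have h := sum_card_quadRadical hF hd he heven (fun r => 2 ^ m - 2 ^ m / r)
  rw [Nat.div_self (Nat.two_pow_pos m), Nat.div_one, Nat.sub_self, mul_zero, add_zero] at h
  rw [← h, Finset.card_filter, Fintype.sum_prod_type]
  refine Finset.sum_congr rfl fun a _ => ?_
  rw [← Finset.card_filter]
  have h1 := card_quadRadical_mul_card_walsh_ne_zero e a
  have h2 := Finset.card_filter_add_card_filter_not (s := (Finset.univ : Finset F))
    (fun b => walsh e a b = 0)
  rw [Finset.card_univ, hF] at h2
  rw [hF] at h1
  rw [← h1, Nat.mul_div_cancel_left _ Nat.card_pos, h1]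
  exact Nat.eq_sub_of_add_eq h2

omit [CharP F 2] in
theorem card_signed_walsh_eq {e : ℕ} {t : ℤ} (ht : t ≠ 0) :
    (Finset.univ.filter fun p : F × F × ZMod 2 =>
      binarySign p.2.2 * walsh e p.1 p.2.1 = t).card =
    (Finset.univ.filter fun p : F × F => walsh e p.1 p.2 ^ 2 = t ^ 2).card := by
  refine Finset.card_nbij (fun p => (p.1, p.2.1)) ?_ ?_ ?_
  · rintro ⟨a, b, c⟩ h
    simp only [Finset.coe_filter, Finset.mem_univ, true_and, Set.mem_ofPred_eq] at h ⊢
    rw [← h, mul_pow, binarySign_sq, one_mul]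
  · rintro ⟨a, b, c⟩ h ⟨a', b', c'⟩ h' hp
    simp only [Finset.coe_filter, Finset.mem_univ, true_and, Set.mem_ofPred_eq] at h h'
    obtain ⟨rfl, rfl⟩ := Prod.mk.inj hp
    have hne : walsh e a b ≠ 0 := by
      intro h0
      rw [h0, mul_zero] at h
      exact ht h.symm
    have hc := mul_right_cancel₀ hne (h.trans h'.symm)
    rw [binarySign_injective hc]
  · rintro ⟨a, b⟩ h
    simp only [Finset.coe_filter, Finset.mem_univ, true_and, Set.mem_ofPred_eq] at h
    rcases sq_eq_sq_iff_eq_or_eq_neg.1 h with h | h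
    · exact ⟨(a, b, 0), by simp [binarySign_eq_ite, h], rfl⟩
    · exact ⟨(a, b, 1), by simp [binarySign_eq_ite, h], rfl⟩

omit [CharP F 2] in
theorem card_signed_walsh_eq_zero (e : ℕ) :
    (Finset.univ.filter fun p : F × F × ZMod 2 =>
      binarySign p.2.2 * walsh e p.1 p.2.1 = 0).card =
    2 * (Finset.univ.filter fun p : F × F => walsh e p.1 p.2 = 0).card := by
  have h (c : ZMod 2) : binarySign c ≠ 0 := by
    rw [binarySign_eq_ite]
    split_ifs <;> norm_num
  simp only [mul_eq_zero, h, false_or, Finset.card_filter, Fintype.sum_prod_type, Finset.mul_sum]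
  refine Finset.sum_congr rfl fun a _ => Finset.sum_congr rfl fun b _ => ?_
  by_cases hS : walsh e a b = 0 <;> simp [hS]

/-- The word `x ↦ Tr(a x^(2^e+1) + b x) + c`. -/
noncomputable def traceWord (F : Type*) [Field F] [Algebra (ZMod 2) F] (e : ℕ) :
    F × F × ZMod 2 →ₗ[ZMod 2] F → ZMod 2 where
  toFun p x := Algebra.trace (ZMod 2) F (p.1 * x ^ (2 ^ e + 1) + p.2.1 * x) + p.2.2
  map_add' p q := by
    ext x
    simp only [Prod.fst_add, Prod.snd_add, Pi.add_apply, add_mul, map_add]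
    ring
  map_smul' k p := by
    ext x
    simp only [Prod.smul_fst, Prod.smul_snd, Pi.smul_apply, smul_mul_assoc, ← smul_add, map_smul,
      RingHom.id_apply]

omit [Fintype F] [CharP F 2] in
theorem traceWord_apply (e : ℕ) (p : F × F × ZMod 2) (x : F) :
    traceWord F e p x =
      Algebra.trace (ZMod 2) F (p.1 * x ^ (2 ^ e + 1) + p.2.1 * x) + p.2.2 := rfl

omit [CharP F 2] in
theorem two_mul_card_traceWord_ne_zero (e : ℕ) (p : F × F × ZMod 2) :
    2 * ((Finset.univ.filter fun x => traceWord F e p x ≠ 0).card : ℤ) =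
      Fintype.card F - binarySign p.2.2 * walsh e p.1 p.2.1 := by
  have h : ∑ x, binarySign (traceWord F e p x) = binarySign p.2.2 * walsh e p.1 p.2.1 := by
    rw [walsh, Finset.mul_sum]
    refine Finset.sum_congr rfl fun x _ => ?_
    rw [traceWord_apply, AddChar.map_add_eq_mul, traceSign_apply, mul_comm]
  rw [← h, sum_binarySign]
  ring

theorem traceWord_injective {m e d : ℕ} (hF : Fintype.card F = 2 ^ m)
    (hd : d = Nat.gcd m e) (he : 1 ≤ e) (heven : Even (m / d)) (hdm : 2 * d < m) :
    Function.Injective (traceWord F e) := by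
  rw [injective_iff_map_eq_zero]
  have hne : (2 : ℤ) ^ m ≠ 0 := by positivity
  have hcard : (Finset.univ.filter fun p : F × F × ZMod 2 =>
      binarySign p.2.2 * walsh e p.1 p.2.1 = 2 ^ m).card ≤ 1 := by
    have h := card_walsh_pair_sq_eq hF hd he heven (2 ^ m) (by positivity)
    have h1 : 2 ^ (2 * d) ≠ 2 ^ m := (Nat.pow_lt_pow_right one_lt_two hdm).ne
    have h2 : 1 ≠ 2 ^ m := (Nat.one_lt_two_pow (by omega)).ne
    rw [if_pos rfl, if_neg h1, if_neg h2, Nat.div_self (by positivity)] at h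
    rw [card_signed_walsh_eq hne, sq ((2 : ℤ) ^ m)]
    push_cast at h
    exact h.le
  have hmem (p : F × F × ZMod 2) (hp : traceWord F e p = 0) :
      binarySign p.2.2 * walsh e p.1 p.2.1 = 2 ^ m := by
    have h := two_mul_card_traceWord_ne_zero e p
    rw [hp, hF] at h
    simp only [Pi.zero_apply, ne_eq, not_true_eq_false, Finset.filter_false, Finset.card_empty] at h
    push_cast at h
    linear_combination h
  intro p hp
  refine Finset.card_le_one.1 hcard p ?_ 0 ?_
  · simpa using hmem p hp
  · simpa using hmem 0 (map_zero _)

end Distribution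

section DualCode

theorem mem_extCode {m e : ℕ} {c : GaloisField 2 m → ZMod 2} :
    c ∈ extCode m e ↔ parF m c = 0 ∧ phiF m 1 c = 0 ∧ phiF m (2 ^ e + 1) c = 0 := by
  simp only [extCode, Submodule.mem_inf, LinearMap.mem_ker, and_assoc]

theorem trace_mul_phiF (m s : ℕ) (a : GaloisField 2 m) (c : GaloisField 2 m → ZMod 2) :
    Algebra.trace (ZMod 2) _ (a * phiF m s c) =
      ∑ x, Algebra.trace (ZMod 2) _ (a * x ^ s) * c x := by
  change Algebra.trace (ZMod 2) _ (a * ∑ g, _) = _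
  rw [Finset.mul_sum, map_sum]
  refine Finset.sum_congr rfl fun x _ => ?_
  rw [mul_left_comm, ← Algebra.smul_def, map_smul, smul_eq_mul, mul_comm]

theorem sum_traceWord_mul (m e : ℕ) (p : GaloisField 2 m × GaloisField 2 m × ZMod 2)
    (c : GaloisField 2 m → ZMod 2) :
    ∑ x, traceWord (GaloisField 2 m) e p x * c x =
      Algebra.trace (ZMod 2) _ (p.1 * phiF m (2 ^ e + 1) c) +
      Algebra.trace (ZMod 2) _ (p.2.1 * phiF m 1 c) + p.2.2 * parF m c := by
  rw [trace_mul_phiF, trace_mul_phiF]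
  change _ = _ + p.2.2 * ∑ g, c g
  rw [Finset.mul_sum, ← Finset.sum_add_distrib, ← Finset.sum_add_distrib]
  refine Finset.sum_congr rfl fun x _ => ?_
  rw [traceWord_apply, map_add, pow_one]
  ring

theorem eq_zero_of_trace_mul_eq_zero {F : Type*} [Field F] [Fintype F] [Algebra (ZMod 2) F] {u : F}
    (h : ∀ a, Algebra.trace (ZMod 2) F (a * u) = 0) : u = 0 := by
  by_contra hu
  have h1 := sum_traceSign_mul u
  simp [traceSign_apply, h, hu] at h1

theorem dualCode_eq_range (m e : ℕ) :
    dualCode m e = LinearMap.range (traceWord (GaloisField 2 m) e) := by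
  let B : LinearMap.BilinForm (ZMod 2) (GaloisField 2 m → ZMod 2) :=
    dotProductBilin (ZMod 2) (ZMod 2)
  have hB (x y : GaloisField 2 m → ZMod 2) : B x y = ∑ g, x g * y g := rfl
  have hrefl : B.IsRefl := by
    intro x y h
    rw [hB] at h ⊢
    simpa only [mul_comm] using h
  have hnd : B.Nondegenerate := by
    refine hrefl.nondegenerate_iff_separatingLeft.2 fun x hx => ?_
    ext g
    simpa [hB, Pi.single_apply] using hx (Pi.single g 1)
  have hdual : dualCode m e = B.orthogonal (extCode m e) := rfl
  have hext : extCode m e = B.orthogonal (LinearMap.range (traceWord (GaloisField 2 m) e)) := by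
    ext c
    rw [mem_extCode, LinearMap.BilinForm.mem_orthogonal_iff]
    constructor
    · rintro ⟨h1, h2, h3⟩ _ ⟨p, rfl⟩
      change B _ _ = 0
      rw [hB, sum_traceWord_mul, h1, h2, h3]
      simp
    · intro h
      have h' (p : GaloisField 2 m × GaloisField 2 m × ZMod 2) := h _ ⟨p, rfl⟩
      change ∀ p, B _ _ = 0 at h'
      simp only [hB, sum_traceWord_mul] at h'
      refine ⟨?_, ?_, ?_⟩
      · simpa using h' (0, 0, 1)
      · exact eq_zero_of_trace_mul_eq_zero fun a => by simpa using h' (0, a, 0)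
      · exact eq_zero_of_trace_mul_eq_zero fun a => by simpa using h' (a, 0, 0)
  rw [hdual, hext, LinearMap.BilinForm.orthogonal_orthogonal hnd hrefl]

theorem two_mul_wt_traceWord {m : ℕ} (hm : m ≠ 0) (e : ℕ)
    (p : GaloisField 2 m × GaloisField 2 m × ZMod 2) :
    2 * (wt (traceWord (GaloisField 2 m) e p) : ℤ) =
      2 ^ m - binarySign p.2.2 * walsh e p.1 p.2.1 := by
  have h := two_mul_card_traceWord_ne_zero e p
  rw [← Nat.card_eq_fintype_card, GaloisField.card 2 m hm] at h
  push_cast at h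
  exact h

theorem card_dualCode_wt_eq {m e : ℕ} (hm : m ≠ 0)
    (hinj : Function.Injective (traceWord (GaloisField 2 m) e)) (w : ℕ) {t : ℤ}
    (ht : 2 ^ m - 2 * (w : ℤ) = t) :
    Nat.card {y : GaloisField 2 m → ZMod 2 // y ∈ dualCode m e ∧ wt y = w} =
      (Finset.univ.filter fun p : GaloisField 2 m × GaloisField 2 m × ZMod 2 =>
        binarySign p.2.2 * walsh e p.1 p.2.1 = t).card := by
  rw [← Fintype.card_subtype, ← Nat.card_eq_fintype_card]
  symm
  have hw (p : GaloisField 2 m × GaloisField 2 m × ZMod 2) :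
      binarySign p.2.2 * walsh e p.1 p.2.1 = t ↔ wt (traceWord (GaloisField 2 m) e p) = w := by
    have := two_mul_wt_traceWord hm e p
    omega
  refine Nat.card_congr (Equiv.ofBijective
    (fun p => ⟨traceWord (GaloisField 2 m) e p.1, ?_, (hw p.1).1 p.2⟩) ⟨?_, ?_⟩)
  · rw [dualCode_eq_range]
    exact LinearMap.mem_range_self _ _
  · intro p q h
    exact Subtype.ext (hinj (congrArg Subtype.val h))
  · rintro ⟨y, hy, hyw⟩
    rw [dualCode_eq_range] at hy
    obtain ⟨p, rfl⟩ := hy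
    exact ⟨⟨p, (hw p).2 hyw⟩, rfl⟩

theorem wt_eq_zero_iff {m : ℕ} {y : GaloisField 2 m → ZMod 2} : wt y = 0 ↔ y = 0 := by
  rw [wt, Finset.card_eq_zero, Finset.filter_eq_empty_iff]
  simp [funext_iff]

end DualCode

/-- When `m/gcd(m,e)` is even, `1 ≤ e < m/2` and `ℓ = 2·gcd(m,e)`, the dual
`C̄_e^⊥` has dimension `2m+1`, weight distribution as in Table VI, and minimum
distance `2^{m-1} - 2^{(m+ℓ-2)/2}`. -/
theorem dualCode_weight_distribution_even_case (m e : ℕ) (hm : 4 ≤ m)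
    (he1 : 1 ≤ e) (he2 : 2 * e < m) (heven : Even (m / Nat.gcd m e))
    (l : ℕ) (hl : l = 2 * Nat.gcd m e) :
    Module.finrank (ZMod 2) (dualCode m e) = 2 * m + 1 ∧
    Nat.card {y : GaloisField 2 m → ZMod 2 // y ∈ dualCode m e ∧ wt y = 0} = 1 ∧
    Nat.card {y : GaloisField 2 m → ZMod 2 // y ∈ dualCode m e ∧ wt y = 2 ^ m} = 1 ∧
    Nat.card {y : GaloisField 2 m → ZMod 2 // y ∈ dualCode m e ∧
        wt y = 2 ^ (m - 1) - 2 ^ ((m + l - 2) / 2)} =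
      2 ^ (m - l) * (2 ^ m - 1) / (2 ^ (l / 2) + 1) ∧
    Nat.card {y : GaloisField 2 m → ZMod 2 // y ∈ dualCode m e ∧
        wt y = 2 ^ (m - 1) + 2 ^ ((m + l - 2) / 2)} =
      2 ^ (m - l) * (2 ^ m - 1) / (2 ^ (l / 2) + 1) ∧
    Nat.card {y : GaloisField 2 m → ZMod 2 // y ∈ dualCode m e ∧
        wt y = 2 ^ (m - 1) - 2 ^ ((m - 2) / 2)} =
      2 ^ ((2 * m + l) / 2) * (2 ^ m - 1) / (2 ^ (l / 2) + 1) ∧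
    Nat.card {y : GaloisField 2 m → ZMod 2 // y ∈ dualCode m e ∧
        wt y = 2 ^ (m - 1) + 2 ^ ((m - 2) / 2)} =
      2 ^ ((2 * m + l) / 2) * (2 ^ m - 1) / (2 ^ (l / 2) + 1) ∧
    Nat.card {y : GaloisField 2 m → ZMod 2 // y ∈ dualCode m e ∧
        wt y = 2 ^ (m - 1)} =
      2 * ((2 ^ (l / 2) - 1) * 2 ^ (m - l) + 1) * (2 ^ m - 1) ∧
    (∀ y ∈ dualCode m e, wt y ∈ ({0,
        2 ^ (m - 1) - 2 ^ ((m + l - 2) / 2), 2 ^ (m - 1) - 2 ^ ((m - 2) / 2),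
        2 ^ (m - 1), 2 ^ (m - 1) + 2 ^ ((m - 2) / 2),
        2 ^ (m - 1) + 2 ^ ((m + l - 2) / 2), 2 ^ m} : Set ℕ)) ∧
    IsLeast {w : ℕ | ∃ y ∈ dualCode m e, y ≠ 0 ∧ wt y = w}
      (2 ^ (m - 1) - 2 ^ ((m + l - 2) / 2)) := by
  subst hl
  set d := Nat.gcd m e with hd
  have hm0 : m ≠ 0 := by omega
  have hd0 : 0 < d := Nat.gcd_pos_of_pos_right m he1
  have hdm : 2 * d < m := by
    have : d ≤ e := Nat.gcd_le_right m he1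
    omega
  obtain ⟨n, rfl⟩ : ∃ n, m = 2 * n := by
    obtain ⟨k, hk⟩ := (heven.mul_left d)
    rw [Nat.mul_div_cancel' (Nat.gcd_dvd_left m e)] at hk
    exact ⟨k, by omega⟩
  have hF : Fintype.card (GaloisField 2 (2 * n)) = 2 ^ (2 * n) := by
    rw [← Nat.card_eq_fintype_card, GaloisField.card 2 _ hm0]
  have hinj := traceWord_injective hF hd he1 heven hdm
  obtain ⟨N, hN⟩ : 2 ^ d + 1 ∣ 2 ^ (2 * n) - 1 :=
    gcd_two_pow_add_one hd he1 heven ▸ Nat.gcd_dvd_left _ _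
  have hNdiv : (2 ^ (2 * n) - 1) / (2 ^ d + 1) = N := by
    rw [hN, Nat.mul_div_cancel_left _ (by positivity)]
  have hsq {t : ℤ} (ht : t ≠ 0) {w : ℕ} (hw : w ≠ 0) (htw : t ^ 2 = 2 ^ (2 * n) * (w : ℤ))
      {x : ℕ} (hx : 2 ^ (2 * n) - 2 * (x : ℤ) = t) :
      Nat.card {y : GaloisField 2 (2 * n) → ZMod 2 // y ∈ dualCode (2 * n) e ∧ wt y = x} =
      (if 2 ^ (2 * n) = w then 2 ^ (2 * n) / w else 0) +
      N * (if 2 ^ (2 * d) = w then 2 ^ (2 * n) / w else 0) +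
      (2 ^ (2 * n) - 1 - N) * (if 1 = w then 2 ^ (2 * n) / w else 0) := by
    rw [card_dualCode_wt_eq hm0 hinj x hx, card_signed_walsh_eq ht, htw, ← hNdiv]
    exact card_walsh_pair_sq_eq hF hd he1 heven w hw
  have hlt1 : 1 < 2 ^ (2 * d) := Nat.one_lt_two_pow (by omega)
  have hlt2 : 2 ^ (2 * d) < 2 ^ (2 * n) := Nat.pow_lt_pow_right one_lt_two hdm
  have hexp1 : (2 * n + 2 * d - 2) / 2 = n + d - 1 := by omega
  have hexp2 : (2 * n - 2) / 2 = n - 1 := by omega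
  have hexp3 : (2 * (2 * n) + 2 * d) / 2 = 2 * n + d := by omega
  have hexp4 : 2 * d / 2 = d := by omega
  rw [hexp1, hexp2, hexp3, hexp4]
  have hA : 2 ^ (2 * n) = 2 * 2 ^ (2 * n - 1) := by rw [← pow_succ']; congr 1; omega
  have hB : 2 ^ (n + d) = 2 * 2 ^ (n + d - 1) := by rw [← pow_succ']; congr 1; omega
  have hC : 2 ^ n = 2 * 2 ^ (n - 1) := by rw [← pow_succ']; congr 1; omega
  have hBA : 2 ^ (n + d - 1) < 2 ^ (2 * n - 1) := Nat.pow_lt_pow_right one_lt_two (by omega)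
  have hCB : 2 ^ (n - 1) < 2 ^ (n + d - 1) := Nat.pow_lt_pow_right one_lt_two (by omega)
  have hC0 : 0 < 2 ^ (n - 1) := by positivity
  have hdivpow : 2 ^ (2 * n) = 2 ^ (2 * n - 2 * d) * 2 ^ (2 * d) := by
    rw [← pow_add, Nat.sub_add_cancel hdm.le]
  have hq : 2 ^ (2 * n) / 2 ^ (2 * d) = 2 ^ (2 * n - 2 * d) := Nat.pow_div hdm.le two_pos
  have hAz : (2 : ℤ) ^ (2 * n) = 2 * ((2 ^ (2 * n - 1) : ℕ) : ℤ) := by exact_mod_cast hA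
  have hsqA : ((2 : ℤ) ^ (2 * n)) ^ 2 = 2 ^ (2 * n) * ((2 ^ (2 * n) : ℕ) : ℤ) := by
    push_cast; ring
  have hsqB : (2 * ((2 ^ (n + d - 1) : ℕ) : ℤ)) ^ 2 = 2 ^ (2 * n) * ((2 ^ (2 * d) : ℕ) : ℤ) := by
    have : 2 * ((2 ^ (n + d - 1) : ℕ) : ℤ) = 2 ^ (n + d) := by exact_mod_cast hB.symm
    rw [this]; push_cast; ring
  have hsqC : (2 * ((2 ^ (n - 1) : ℕ) : ℤ)) ^ 2 = 2 ^ (2 * n) * ((1 : ℕ) : ℤ) := by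
    have : 2 * ((2 ^ (n - 1) : ℕ) : ℤ) = 2 ^ n := by exact_mod_cast hC.symm
    rw [this]; push_cast; ring
  have hcountB : 2 ^ (2 * n - 2 * d) * (2 ^ (2 * n) - 1) / (2 ^ d + 1) =
      N * 2 ^ (2 * n - 2 * d) := by
    rw [Nat.mul_div_assoc _ ⟨N, hN⟩, hNdiv, mul_comm]
  have hcountC : 2 ^ (2 * n + d) * (2 ^ (2 * n) - 1) / (2 ^ d + 1) =
      (2 ^ (2 * n) - 1 - N) * 2 ^ (2 * n) := by
    rw [Nat.mul_div_assoc _ ⟨N, hN⟩, hNdiv, hN, add_one_mul, Nat.add_sub_cancel]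
    ring
  have hmin : 0 < N * 2 ^ (2 * n - 2 * d) := by
    refine Nat.mul_pos (Nat.pos_of_ne_zero ?_) (by positivity)
    rintro rfl
    omega
  have hcardB {x : ℕ} (hx : 2 ^ (2 * n) - 2 * (x : ℤ) = 2 * ((2 ^ (n + d - 1) : ℕ) : ℤ) ∨
      2 ^ (2 * n) - 2 * (x : ℤ) = -(2 * ((2 ^ (n + d - 1) : ℕ) : ℤ))) :
      Nat.card {y : GaloisField 2 (2 * n) → ZMod 2 // y ∈ dualCode (2 * n) e ∧ wt y = x} =
        N * 2 ^ (2 * n - 2 * d) := by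
    rcases hx with hx | hx
    · rw [hsq (by omega) (by positivity) hsqB hx, if_neg hlt2.ne', if_pos rfl, if_neg hlt1.ne, hq]
      ring
    · rw [hsq (by omega) (by positivity) ((neg_sq _).trans hsqB) hx, if_neg hlt2.ne', if_pos rfl,
        if_neg hlt1.ne, hq]
      ring
  have hcardC {x : ℕ} (hx : 2 ^ (2 * n) - 2 * (x : ℤ) = 2 * ((2 ^ (n - 1) : ℕ) : ℤ) ∨
      2 ^ (2 * n) - 2 * (x : ℤ) = -(2 * ((2 ^ (n - 1) : ℕ) : ℤ))) :
      Nat.card {y : GaloisField 2 (2 * n) → ZMod 2 // y ∈ dualCode (2 * n) e ∧ wt y = x} =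
        (2 ^ (2 * n) - 1 - N) * 2 ^ (2 * n) := by
    rcases hx with hx | hx
    · rw [hsq (by omega) one_ne_zero hsqC hx, if_neg (hlt1.trans hlt2).ne', if_neg hlt1.ne',
        if_pos rfl, Nat.div_one]
      ring
    · rw [hsq (by omega) one_ne_zero ((neg_sq _).trans hsqC) hx, if_neg (hlt1.trans hlt2).ne',
        if_neg hlt1.ne', if_pos rfl, Nat.div_one]
      ring
  have hweights : ∀ y ∈ dualCode (2 * n) e, wt y ∈ ({0,
      2 ^ (2 * n - 1) - 2 ^ (n + d - 1), 2 ^ (2 * n - 1) - 2 ^ (n - 1),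
      2 ^ (2 * n - 1), 2 ^ (2 * n - 1) + 2 ^ (n - 1),
      2 ^ (2 * n - 1) + 2 ^ (n + d - 1), 2 ^ (2 * n)} : Set ℕ) := by
    intro y hy
    rw [dualCode_eq_range] at hy
    obtain ⟨p, rfl⟩ := hy
    have hwt := two_mul_wt_traceWord hm0 e p
    have hv : (binarySign p.2.2 * walsh e p.1 p.2.1) ^ 2 = walsh e p.1 p.2.1 ^ 2 := by
      rw [mul_pow, binarySign_sq, one_mul]
    generalize binarySign p.2.2 * walsh e p.1 p.2.1 = v at hwt hv
    simp only [Set.mem_insert_iff, Set.mem_singleton_iff]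
    rcases walsh_sq_eq_zero_or e p.1 p.2.1 with h | h
    · rw [h] at hv
      have := pow_eq_zero_iff two_ne_zero |>.1 hv
      omega
    · rw [h, hF, Nat.cast_pow, Nat.cast_ofNat] at hv
      rcases card_quadRadical_mem hF hd he1 heven p.1 with h | h | h
      · rw [h, ← hsqA] at hv
        rcases sq_eq_sq_iff_eq_or_eq_neg.1 hv with h | h <;> omega
      · rw [h, ← hsqB] at hv
        rcases sq_eq_sq_iff_eq_or_eq_neg.1 hv with h | h <;> omega
      · rw [h, ← hsqC] at hv
        rcases sq_eq_sq_iff_eq_or_eq_neg.1 hv with h | h <;> omega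
  refine ⟨?_, ?_, ?_, ?_, ?_, ?_, ?_, ?_, hweights, ?_, ?_⟩
  · rw [dualCode_eq_range, LinearMap.finrank_range_of_inj hinj, Module.finrank_prod,
      Module.finrank_prod, GaloisField.finrank 2 hm0, Module.finrank_self]
    ring
  · rw [hsq (by positivity) (by positivity) hsqA (by simp), if_pos rfl, if_neg hlt2.ne,
      if_neg (hlt1.trans hlt2).ne, Nat.div_self (by positivity), mul_zero,
      mul_zero, add_zero, add_zero]
  · rw [hsq (t := -2 ^ (2 * n)) (neg_ne_zero.2 (by positivity)) (by positivity)
      ((neg_sq _).trans hsqA) (by push_cast; ring), if_pos rfl, if_neg hlt2.ne,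
      if_neg (hlt1.trans hlt2).ne, Nat.div_self (by positivity), mul_zero,
      mul_zero, add_zero, add_zero]
  · rw [hcountB, hcardB (by omega)]
  · rw [hcountB, hcardB (by omega)]
  · rw [hcountC, hcardC (by omega)]
  · rw [hcountC, hcardC (by omega)]
  · rw [card_dualCode_wt_eq hm0 hinj _ (t := 0) (by omega), card_signed_walsh_eq_zero,
      card_walsh_pair_eq_zero hF hd he1 heven, hNdiv, hq]
    have h1 : 2 ^ (2 * n) - 2 ^ (2 * n - 2 * d) =
        2 ^ (2 * n - 2 * d) * ((2 ^ d + 1) * (2 ^ d - 1)) := by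
      have hfac : 2 ^ (2 * d) - 1 = (2 ^ d + 1) * (2 ^ d - 1) := by
        rw [mul_comm 2 d, pow_mul, ← one_pow 2, Nat.sq_sub_sq, one_pow]
      rw [← hfac, Nat.mul_sub, mul_one, ← hdivpow]
    rw [h1, hN]
    ring
  · have hpos := hmin
    rw [← hcardB (x := 2 ^ (2 * n - 1) - 2 ^ (n + d - 1)) (by omega)] at hpos
    obtain ⟨⟨y, hy, hyw⟩⟩ := (Nat.card_pos_iff.1 hpos).1
    refine ⟨y, hy, fun h0 => ?_, hyw⟩
    rw [wt_eq_zero_iff.2 h0] at hyw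
    omega
  · rintro w ⟨y, hy, hy0, rfl⟩
    have h := hweights y hy
    simp only [Set.mem_insert_iff, Set.mem_singleton_iff] at h
    have h0 : wt y ≠ 0 := fun h => hy0 (wt_eq_zero_iff.1 h)
    omega
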